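/- arXiv:math/0407180 — 8 statements merged into one kernel-verified Lean document; each statement's English description precedes it below -/
import Mathlib

section
/- Let C be a commutative ring. For sequences a, b : ℕ → C define the Hurwitz product (a ⋆ b)(n) = Σ_{k=0}^{n} C(n,k)·a(k)·b(n−k) (where C(n,k) is the binomial coefficient), and define the shift operator P by P(a)(0) = 0 and P(a)(n+1) = a(n). Then for all sequences a, b and all n ∈ ℕ, (P(a) ⋆ P(b))(n) = P(a ⋆ P(b))(n) + P(b ⋆ P(a))(n). In other words, the shift operator is a Baxter operator of weight 0 on the ring of Hurwitz series over C. -/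
/-- The Hurwitz product of two sequences:
`(a ⋆ b)(n) = Σ_{k=0}^{n} C(n,k)·a(k)·b(n−k)`. -/
def hurwitzMul {C : Type*} [CommRing C] (a b : ℕ → C) : ℕ → C :=
  fun n => ∑ k ∈ Finset.range (n + 1), (n.choose k : C) * a k * b (n - k)

/-- The shift operator on Hurwitz series: `P(a)(0) = 0`, `P(a)(n+1) = a(n)`. -/
def hurwitzShift {C : Type*} [CommRing C] (a : ℕ → C) : ℕ → C :=
  fun n => match n with
  | 0 => 0
  | n + 1 => a n

theorem hurwitzShift_zero {C : Type*} [CommRing C] (a : ℕ → C) : hurwitzShift a 0 = 0 := rfl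

theorem hurwitzShift_succ {C : Type*} [CommRing C] (a : ℕ → C) (n : ℕ) :
    hurwitzShift a (n + 1) = a n := rfl

theorem hurwitzMul_comm {C : Type*} [CommRing C] (a b : ℕ → C) :
    hurwitzMul a b = hurwitzMul b a := by
  funext n
  unfold hurwitzMul
  rw [← Finset.sum_range_reflect]
  refine Finset.sum_congr rfl fun k hk => ?_
  have hk' : k ≤ n := Nat.lt_succ_iff.mp (Finset.mem_range.mp hk)
  rw [Nat.add_sub_cancel, Nat.choose_symm hk', Nat.sub_sub_self hk']
  ring

/-- The shift operator is a Baxter operator of weight 0 on the ring of Hurwitz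
series over a commutative ring `C`. -/
theorem hurwitzShift_is_baxter_weight_zero {C : Type*} [CommRing C]
    (a b : ℕ → C) (n : ℕ) :
    hurwitzMul (hurwitzShift a) (hurwitzShift b) n =
      hurwitzShift (hurwitzMul a (hurwitzShift b)) n +
      hurwitzShift (hurwitzMul b (hurwitzShift a)) n := by
  cases n with
  | zero => simp [hurwitzMul, hurwitzShift_zero]
  | succ n =>
    rw [hurwitzMul_comm b, hurwitzShift_succ, hurwitzShift_succ]
    unfold hurwitzMul
    rw [Finset.sum_range_succ' _ (n + 1),
      Finset.sum_range_succ' (fun k => (n.choose k : C) * hurwitzShift a k * b (n - k))]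
    simp only [hurwitzShift_zero, hurwitzShift_succ, Nat.choose_succ_succ', Nat.cast_add, add_mul,
      Finset.sum_add_distrib, Nat.add_sub_add_right, mul_zero, zero_mul, add_zero]
    congr 1
    rw [Finset.sum_range_succ, Nat.sub_self, hurwitzShift_zero, mul_zero, add_zero]
    refine Finset.sum_congr rfl fun k hk => ?_
    obtain ⟨m, rfl⟩ := Nat.exists_eq_add_of_lt (Finset.mem_range.mp hk)
    rw [show k + m + 1 - k = m + 1 by lia, show k + m + 1 - (k + 1) = m by lia,
      hurwitzShift_succ]
end

section
/- Let C be a commutative ℚ-algebra and let R = C[t] be the polynomial algebra. Let P be a C-linear operator on R with P(1) = t. Then P is a Baxter operator of weight −1 on R if and only if, for every n ≥ 0 and every integer k ≥ 1, the evaluation of the polynomial P(tⁿ) at t = k equals Σ_{r=1}^{k} rⁿ (computed in C via the canonical map ℕ → C). -/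
/-- Multiplication by a positive natural number is injective in a `ℚ`-algebra. -/
theorem natCast_succ_mul_cancel {A : Type*} [CommRing A] [Algebra ℚ A] (n : ℕ) {x y : A}
    (h : ((n : A) + 1) * x = ((n : A) + 1) * y) : x = y := by
  have hn : algebraMap ℚ A ((n : ℚ) + 1)⁻¹ * ((n : A) + 1) = 1 := by
    have h0 : ((n : ℚ) + 1) ≠ 0 := by positivity
    have := congrArg (algebraMap ℚ A) (inv_mul_cancel₀ h0)
    simpa only [map_mul, map_add, map_natCast, map_one] using this
  linear_combination algebraMap ℚ A ((n : ℚ) + 1)⁻¹ * h - (x - y) * hn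

/-- Over a `ℚ`-algebra, a polynomial vanishing at all large natural numbers is zero. -/
theorem Polynomial.eq_zero_of_eval_natCast_eq_zero {C : Type*} [CommRing C] [Algebra ℚ C]
    (p : Polynomial C) (m : ℕ) (hp : ∀ k : ℕ, m ≤ k → p.eval (k : C) = 0) : p = 0 := by
  nontriviality C
  induction hd : p.natDegree generalizing p m with
  | zero =>
    rw [Polynomial.eq_C_of_natDegree_eq_zero hd] at hp ⊢
    simpa using hp m le_rfl
  | succ d ih =>
    have hmul := Polynomial.mul_divByMonic_eq_iff_isRoot.2 (hp m le_rfl)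
    have hq : p /ₘ (Polynomial.X - Polynomial.C (m : C)) = 0 := by
      refine ih _ (m + 1) (fun k hk => ?_) ?_
      · obtain ⟨j, rfl⟩ := Nat.exists_eq_add_of_le hk
        have hk0 := hp (m + 1 + j) (by omega)
        rw [← hmul] at hk0
        apply natCast_succ_mul_cancel j
        simp only [Polynomial.eval_mul, Polynomial.eval_sub, Polynomial.eval_X,
          Polynomial.eval_C] at hk0
        push_cast at hk0 ⊢
        linear_combination hk0
      · rw [Polynomial.natDegree_divByMonic _ (Polynomial.monic_X_sub_C _), hd,
          Polynomial.natDegree_X_sub_C, Nat.add_sub_cancel]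
    rw [← hmul, hq, mul_zero]

/-- The product of two partial sums satisfies the Baxter identity of weight `-1`. -/
theorem Finset.sum_Icc_mul_sum_Icc {C : Type*} [CommRing C] (a b : ℕ → C) (k : ℕ) :
    (∑ r ∈ Finset.Icc 1 k, a r) * ∑ r ∈ Finset.Icc 1 k, b r =
      ∑ r ∈ Finset.Icc 1 k, a r * ∑ s ∈ Finset.Icc 1 r, b s +
        ∑ r ∈ Finset.Icc 1 k, b r * ∑ s ∈ Finset.Icc 1 r, a s -
          ∑ r ∈ Finset.Icc 1 k, a r * b r := by
  induction k with
  | zero => simp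
  | succ k ih =>
    simp only [Finset.sum_Icc_succ_top (Nat.le_add_left 1 k)]
    linear_combination ih

/-- Summing rising factorials: `(n + 1) ∑_{r = 1}^k r (r + 1) ⋯ (r + n - 1) = k (k + 1) ⋯ (k + n)`. -/
theorem sum_Icc_eval_ascPochhammer {C : Type*} [CommRing C] (n k : ℕ) :
    ((n : C) + 1) * ∑ r ∈ Finset.Icc 1 k, (ascPochhammer C n).eval (r : C) =
      (ascPochhammer C (n + 1)).eval (k : C) := by
  induction k with
  | zero => simp
  | succ k ih =>
    rw [Finset.sum_Icc_succ_top (Nat.le_add_left 1 k), mul_add, ih, ascPochhammer_succ_eval n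
      ((k + 1 : ℕ) : C), ascPochhammer_succ_left]
    simp only [Polynomial.eval_mul, Polynomial.eval_X, Polynomial.eval_comp, Polynomial.eval_add,
      Polynomial.eval_one]
    push_cast
    ring

/-- A Baxter operator of weight `-1` with `P 1 = X` raises the degree of rising factorials. -/
theorem baxter_ascPochhammer {C : Type*} [CommRing C] [Algebra ℚ C]
    (P : Polynomial C →ₗ[C] Polynomial C) (h1 : P 1 = Polynomial.X)
    (hP : ∀ u v : Polynomial C, P u * P v = P (u * P v) + P (v * P u) - P (u * v)) (n : ℕ) :
    ((n : Polynomial C) + 1) * P (ascPochhammer C n) = ascPochhammer C (n + 1) := by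
  induction n with
  | zero => simp [h1]
  | succ n ih =>
    have hmul (j : ℕ) (f : Polynomial C) : P ((j : Polynomial C) * f) = j * P f := by
      rw [← nsmul_eq_mul, map_nsmul, nsmul_eq_mul]
    have hrec := ascPochhammer_succ_right C n
    have hX : P (ascPochhammer C n * Polynomial.X) =
        P (ascPochhammer C (n + 1)) - n * P (ascPochhammer C n) := by
      rw [← hmul, ← map_sub, hrec]
      congr 1
      ring
    have hPP : P (ascPochhammer C (n + 1)) = ((n : Polynomial C) + 1) * P (P (ascPochhammer C n)) := by
      rw [← ih]
      exact_mod_cast hmul (n + 1) _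
    have hb := hP 1 (ascPochhammer C n)
    rw [h1, one_mul, one_mul, hX] at hb
    rw [ascPochhammer_succ_right C (n + 1)]
    push_cast
    linear_combination (-(n : Polynomial C) - 1) * hb + hPP +
      (Polynomial.X + (n : Polynomial C) + 1) * ih


/-- Let `C` be a commutative `ℚ`-algebra and `P` a `C`-linear operator on `C[t]`
with `P(1) = t`.  Then `P` is a Baxter operator of weight `−1` if and only if for
every `n ≥ 0` and every integer `k ≥ 1`, the value of the polynomial `P(tⁿ)` at
`t = k` equals `Σ_{r=1}^{k} rⁿ` (computed in `C` via the canonical map `ℕ → C`). -/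
theorem baxter_weight_neg_one_iff_summation {C : Type*} [CommRing C] [Algebra ℚ C]
    (P : Polynomial C →ₗ[C] Polynomial C) (h1 : P 1 = Polynomial.X) :
    (∀ u v : Polynomial C, P u * P v = P (u * P v) + P (v * P u) - P (u * v)) ↔
      ∀ (n : ℕ) (k : ℕ), 1 ≤ k →
        Polynomial.eval ((k : C)) (P (Polynomial.X ^ n)) =
          ∑ r ∈ Finset.Icc 1 k, (r : C) ^ n := by
  have heval : (∀ (n k : ℕ), 1 ≤ k → Polynomial.eval (k : C) (P (Polynomial.X ^ n)) =
      ∑ r ∈ Finset.Icc 1 k, (r : C) ^ n) → ∀ (f : Polynomial C) (k : ℕ), 1 ≤ k →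
      (P f).eval (k : C) = ∑ r ∈ Finset.Icc 1 k, f.eval (r : C) := by
    intro h f k hk
    induction f using Polynomial.induction_on' with
    | add f g hf hg => simp [hf, hg, Finset.sum_add_distrib]
    | monomial n a =>
      rw [← mul_one a, ← smul_eq_mul, ← Polynomial.smul_monomial, map_smul,
        Polynomial.monomial_one_right_eq_X_pow, Polynomial.eval_smul, h n k hk]
      simp [Finset.mul_sum]
  constructor
  · intro hP
    have hsum (m : ℕ) : ∀ n k : ℕ, (P (Polynomial.X ^ m * ascPochhammer C n)).eval (k : C) =
        ∑ r ∈ Finset.Icc 1 k, (Polynomial.X ^ m * ascPochhammer C n).eval (r : C) := by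
      induction m with
      | zero =>
        intro n k
        apply natCast_succ_mul_cancel n
        have h := congrArg (Polynomial.eval (k : C)) (baxter_ascPochhammer P h1 hP n)
        simp only [pow_zero, one_mul, sum_Icc_eval_ascPochhammer]
        simpa using h
      | succ m ih =>
        intro n k
        have hX : Polynomial.X ^ (m + 1) * ascPochhammer C n =
            Polynomial.X ^ m * ascPochhammer C (n + 1) -
              n • (Polynomial.X ^ m * ascPochhammer C n) := by
          rw [ascPochhammer_succ_right, nsmul_eq_mul]
          ring
        rw [hX, map_sub, map_nsmul, Polynomial.eval_sub, Polynomial.eval_smul, ih, ih]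
        simp only [Polynomial.eval_sub, Polynomial.eval_smul, Finset.sum_sub_distrib,
          Finset.smul_sum]
    intro n k _
    simpa using hsum n 0 k
  · intro h u v
    rw [← sub_eq_zero]
    refine Polynomial.eq_zero_of_eval_natCast_eq_zero _ 1 fun k hk => ?_
    have hs (f g : Polynomial C) : ∑ r ∈ Finset.Icc 1 k, (f * P g).eval (r : C) =
        ∑ r ∈ Finset.Icc 1 k, f.eval (r : C) * ∑ s ∈ Finset.Icc 1 r, g.eval (s : C) :=
      Finset.sum_congr rfl fun r hr => by
        rw [Polynomial.eval_mul, heval h g r (Finset.mem_Icc.1 hr).1]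
    simp only [Polynomial.eval_sub, Polynomial.eval_add, Polynomial.eval_mul (p := P u),
      heval h _ k hk, hs]
    rw [Finset.sum_Icc_mul_sum_Icc]
    simp only [Polynomial.eval_mul, sub_self]
end

section
/- Let C be a commutative ℚ-algebra and let (R, P) be a Baxter C-algebra of weight −1. Set t = P(1). Then for every n ≥ 1, P(tⁿ) = Φ_{n+1}(t+1)/(n+1), where the polynomial Φ_{n+1}(x+1) ∈ ℚ[x] is evaluated at t via the canonical ℚ-algebra map ℚ[x] → R sending x to t. -/
/-- `Φ_n(x) = B_n(x) − B_n`, where `B_n(x)` is the `n`-th Bernoulli polynomial and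
`B_n = B_n(0)` is the `n`-th Bernoulli number. -/
noncomputable def PhiBernoulli (n : ℕ) : Polynomial ℚ :=
  Polynomial.bernoulli n - Polynomial.C (bernoulli n)

/-- A Baxter operator of weight `-1` sends the backward difference of `x ^ (m + 1)`, evaluated
at `P 1`, to `P 1 ^ (m + 1)`. -/
theorem baxter_pow_sub_pow {R : Type*} [CommRing R] (P : R →+ R)
    (hP : ∀ u v : R, P u * P v = P (u * P v) + P (v * P u) - P (u * v)) (m : ℕ) :
    P (P 1 ^ (m + 1) - (P 1 - 1) ^ (m + 1)) = P 1 ^ (m + 1) := by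
  induction m with
  | zero => simp
  | succ m ih =>
    have h := hP 1 (P 1 ^ (m + 1) - (P 1 - 1) ^ (m + 1))
    rw [ih, ← map_add, ← map_sub] at h
    refine Eq.trans (congrArg P ?_) (h.symm.trans (pow_succ' _ _).symm)
    ring

/-- A Baxter operator of weight `-1` inverts the backward difference operator on polynomials
in `P 1`, up to the constant term. -/
theorem baxter_aeval_sub_aeval {R : Type*} [CommRing R] [Algebra ℚ R] (P : R →+ R)
    (hP : ∀ u v : R, P u * P v = P (u * P v) + P (v * P u) - P (u * v)) (F : Polynomial ℚ) :
    P (Polynomial.aeval (P 1) F - Polynomial.aeval (P 1 - 1) F) =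
      Polynomial.aeval (P 1) F - algebraMap ℚ R (F.eval 0) := by
  induction F using Polynomial.induction_on' with
  | add p q hp hq =>
    simp only [map_add (Polynomial.aeval _), map_add (algebraMap ℚ R), Polynomial.eval_add]
    rw [add_sub_add_comm, map_add, hp, hq]
    ring
  | monomial n a =>
    cases n with
    | zero => simp
    | succ m =>
      rw [Polynomial.aeval_monomial, Polynomial.aeval_monomial, ← mul_sub, ← Algebra.smul_def,
        map_rat_smul, baxter_pow_sub_pow P hP, Algebra.smul_def]
      simp

/-- Let `C` be a commutative `ℚ`-algebra and `(R, P)` a Baxter `C`-algebra of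
weight `−1`.  With `t = P(1)`, for every `n ≥ 1` we have
`P(tⁿ) = Φ_{n+1}(t+1)/(n+1)`, where `Φ_{n+1}(x+1) ∈ ℚ[x]` is evaluated at `t`
via the canonical `ℚ`-algebra map `ℚ[x] → R` sending `x` to `t`. -/
theorem baxter_weight_neg_one_power_formula {C R : Type*} [CommRing C] [Algebra ℚ C]
    [CommRing R] [Algebra C R] [Algebra ℚ R] [IsScalarTower ℚ C R]
    (P : R →ₗ[C] R)
    (hP : ∀ u v : R, P u * P v = P (u * P v) + P (v * P u) - P (u * v)) :
    ∀ n : ℕ, 1 ≤ n →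
      P (P 1 ^ n) =
        (((n : ℚ) + 1)⁻¹) • Polynomial.aeval (P 1 + 1 : R) (PhiBernoulli (n + 1)) := by
  intro n hn
  have hB : (Polynomial.bernoulli (n + 1)).eval 1 = bernoulli (n + 1) := by
    rw [Polynomial.bernoulli_eval_one, bernoulli_eq_bernoulli'_of_ne_one (by omega)]
  have h := baxter_aeval_sub_aeval P.toAddMonoidHom hP
    ((Polynomial.bernoulli (n + 1)).comp (1 + Polynomial.X))
  have hdiff : Polynomial.aeval (P 1) ((Polynomial.bernoulli (n + 1)).comp (1 + Polynomial.X)) -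
      Polynomial.aeval (P 1 - 1) ((Polynomial.bernoulli (n + 1)).comp (1 + Polynomial.X)) =
      ((n : ℚ) + 1) • P 1 ^ n := by
    rw [Polynomial.aeval_comp (x := P 1 - 1), Polynomial.bernoulli_comp_one_add_X]
    simp [Algebra.smul_def]
  simp only [LinearMap.toAddMonoidHom_coe] at h
  rw [hdiff, map_rat_smul] at h
  have hn0 : (n : ℚ) + 1 ≠ 0 := by positivity
  rw [eq_inv_smul_iff₀ hn0, h, PhiBernoulli, Polynomial.aeval_comp]
  simp [hB, add_comm]
end

section
/- Let C be a commutative ℚ-algebra and λ ∈ C. In C[x] define p_n(x) = x(x−λ)(x−2λ)⋯(x−(n−1)λ)/n! for n ≥ 0 (so p_0 = 1). Then for all m, n ≥ 0, p_m·p_n = Σ_{k=0}^{m} C(m+n−k, n)·C(n, k)·λᵏ·p_{m+n−k}, where C(a,b) denotes the binomial coefficient. (This realizes, under the isomorphism 1^{⊗(n+1)} ↦ p_n, the mixable shuffle product formula 1^{⊗(m+1)}·1^{⊗(n+1)} = Σ_{k=0}^{m} C(m+n−k,n)C(n,k)λᵏ 1^{⊗(m+n+1−k)} in the free Baxter algebra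 Ш_C(C,λ) on the empty set.) -/
/-- `p_n(x) = x(x−λ)(x−2λ)⋯(x−(n−1)λ)/n!` in `C[x]`, for `C` a commutative
`ℚ`-algebra and `λ ∈ C`.  These are the images of the elements `1^{⊗(n+1)}` of the
mixable shuffle (free) Baxter algebra `Ш_C(C,λ)` under the canonical isomorphism
`Ш_C(C,λ) ≅ C[x]`. -/
noncomputable def mixablePoly {C : Type*} [CommRing C] [Algebra ℚ C] (lam : C)
    (n : ℕ) : Polynomial C :=
  ((n.factorial : ℚ)⁻¹) • ∏ i ∈ Finset.range n, (Polynomial.X - Polynomial.C ((i : C) * lam))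

namespace mixablePoly

open Polynomial

variable {C : Type*} [CommRing C] [Algebra ℚ C] (lam : C)

theorem zero : mixablePoly lam 0 = 1 := by simp [mixablePoly]

theorem succ_mul (n : ℕ) :
    ((n : C[X]) + 1) * mixablePoly lam (n + 1) =
      (X - Polynomial.C ((n : C) * lam)) * mixablePoly lam n := by
  have h : ((n : C[X]) + 1) = algebraMap ℚ C[X] ((n : ℚ) + 1) := by simp
  have hq : ((n : ℚ) + 1) * (((n + 1).factorial : ℚ)⁻¹) = ((n.factorial : ℚ)⁻¹) := by
    have : ((n : ℚ) + 1) ≠ 0 := by positivity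
    rw [Nat.factorial_succ]
    push_cast
    field_simp
  rw [h, ← Algebra.smul_def, mixablePoly, mixablePoly, smul_smul, hq, Finset.prod_range_succ,
    mul_smul_comm, mul_comm]

theorem X_mul (n : ℕ) :
    X * mixablePoly lam n = ((n : C[X]) + 1) * mixablePoly lam (n + 1) +
      (n : C[X]) * Polynomial.C lam * mixablePoly lam n := by
  rw [succ_mul]
  simp only [map_mul, map_natCast]
  ring

end mixablePoly

theorem Nat.cast_choose_mul_sub {R : Type*} [CommRing R] (n k : ℕ) :
    (n.choose k : R) * ((n : R) - k) = (n.choose (k + 1) : R) * (k + 1) := by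
  rcases le_or_gt k n with h | h
  · rw [← Nat.cast_sub h]
    exact_mod_cast congrArg (Nat.cast (R := R)) (Nat.choose_succ_right_eq n k).symm
  · simp [Nat.choose_eq_zero_of_lt h, Nat.choose_eq_zero_of_lt (Nat.lt_succ_of_lt h)]

theorem Nat.cast_add_choose_mul_succ {R : Type*} [CommSemiring R] (r n : ℕ) :
    ((r + n).choose n : R) * ((r : R) + n + 1) = ((r + n + 1).choose n : R) * (r + 1) := by
  have h := Nat.choose_mul_succ_eq (r + n) n
  rw [show r + n + 1 - n = r + 1 by omega] at h
  exact_mod_cast congrArg (Nat.cast (R := R)) h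

/-- The mixable shuffle product formula
`1^{⊗(m+1)} · 1^{⊗(n+1)} = Σ_{k=0}^{m} C(m+n−k,n)·C(n,k)·λᵏ·1^{⊗(m+n+1−k)}`
in the free Baxter algebra `Ш_C(C,λ)`, realized in `C[x]` via `1^{⊗(n+1)} ↦ p_n`:
`p_m·p_n = Σ_{k=0}^{m} C(m+n−k,n)·C(n,k)·λᵏ·p_{m+n−k}`. -/
theorem mixablePoly_mul {C : Type*} [CommRing C] [Algebra ℚ C] (lam : C) (m n : ℕ) :
    mixablePoly lam m * mixablePoly lam n =
      ∑ k ∈ Finset.range (m + 1),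
        Polynomial.C ((((m + n - k).choose n : C)) * ((n.choose k : C)) * lam ^ k) *
          mixablePoly lam (m + n - k) := by
  open Polynomial in
  induction m with
  | zero => simp [mixablePoly.zero]
  | succ m ih =>
    have hunit : IsUnit ((m : C[X]) + 1) := by
      have h : ((m : C[X]) + 1) = algebraMap ℚ C[X] ((m : ℚ) + 1) := by simp
      rw [h]
      exact (IsUnit.mk0 _ (by positivity)).map _
    apply hunit.mul_left_cancel
    rw [← mul_assoc, mixablePoly.succ_mul, mul_assoc, ih, Finset.mul_sum, Finset.mul_sum]
    set A : ℕ → C[X] := fun k => (n.choose k : C[X]) * ((m : C[X]) + 1 - k) *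
      ((m + 1 + n - k).choose n : C[X]) * Polynomial.C lam ^ k * mixablePoly lam (m + 1 + n - k)
      with hA
    set B : ℕ → C[X] := fun k => (n.choose k : C[X]) * k *
      ((m + 1 + n - k).choose n : C[X]) * Polynomial.C lam ^ k * mixablePoly lam (m + 1 + n - k)
      with hB
    have hAB : ∑ k ∈ Finset.range (m + 1 + 1), (A k + B k) =
        ∑ k ∈ Finset.range (m + 1), (A k + B (k + 1)) := by
      rw [Finset.sum_add_distrib, Finset.sum_range_succ A, Finset.sum_range_succ' B,
        Finset.sum_add_distrib]
      simp [hA, hB]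
    trans ∑ k ∈ Finset.range (m + 1 + 1), (A k + B k)
    · rw [hAB]
      refine Finset.sum_congr rfl fun k hk => ?_
      obtain ⟨r, rfl⟩ := Nat.exists_eq_add_of_le' (Nat.lt_succ_iff.mp (Finset.mem_range.mp hk))
      have e₁ : r + k + n - k = r + n := by omega
      have e₂ : r + k + 1 + n - k = r + n + 1 := by omega
      have e₃ : r + k + 1 + n - (k + 1) = r + n := by omega
      have hX := mixablePoly.X_mul lam (r + n)
      have h₁ := Nat.cast_choose_mul_sub (R := C[X]) n k
      have h₂ := Nat.cast_add_choose_mul_succ (R := C[X]) r n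
      simp only [hA, hB, e₁, e₂, e₃, map_mul, map_pow, map_natCast]
      push_cast at hX ⊢
      linear_combination
        ((r + n).choose n : C[X]) * (n.choose k : C[X]) * Polynomial.C lam ^ k * hX +
        (n.choose k : C[X]) * Polynomial.C lam ^ k * mixablePoly lam (r + n + 1) * h₂ +
        ((r + n).choose n : C[X]) * Polynomial.C lam ^ (k + 1) * mixablePoly lam (r + n) * h₁
    · refine Finset.sum_congr rfl fun k _ => ?_
      simp only [hA, hB, map_mul, map_pow, map_natCast]
      ring
end

section
/- Let C be a commutative ℚ-algebra and λ ∈ C. In C[x] define p_n(x) = x(x−λ)(x−2λ)⋯(x−(n−1)λ)/n! for n ≥ 0 (so p_0 = 1, p_1 = x). If Q : C[x] → C[x] is a C-linear map with Q(p_n) = p_{n+1} for all n ≥ 0, then Q is a Baxter operator of weight λ, i.e., Q(u)Q(v) = Q(uQ(v)) + Q(vQ(u)) + λQ(uv) for all u, v ∈ C[x]. In particular Q(1) = x. -/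
section MixablePoly

variable {C : Type*} [CommRing C] [Algebra ℚ C] (lam : C)

@[simp]
theorem mixablePoly_zero : mixablePoly lam 0 = 1 := by
  simp [mixablePoly]

@[simp]
theorem mixablePoly_one : mixablePoly lam 1 = Polynomial.X := by
  simp [mixablePoly]

theorem succ_smul_mixablePoly_succ (n : ℕ) :
    ((n : C) + 1) • mixablePoly lam (n + 1) =
      (Polynomial.X - Polynomial.C ((n : C) * lam)) * mixablePoly lam n := by
  have hn : (n + 1 : ℚ) * ((n + 1).factorial : ℚ)⁻¹ = (n.factorial : ℚ)⁻¹ := by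
    rw [Nat.factorial_succ]
    push_cast
    field_simp
  have hcast : (n : C) + 1 = algebraMap ℚ C (n + 1 : ℚ) := by simp
  rw [mixablePoly, mixablePoly, hcast, algebraMap_smul, smul_smul, hn,
    Finset.prod_range_succ, mul_smul_comm, mul_comm]

theorem X_mul_mixablePoly (n : ℕ) :
    Polynomial.X * mixablePoly lam n =
      ((n : C) + 1) • mixablePoly lam (n + 1) + ((n : C) * lam) • mixablePoly lam n := by
  rw [succ_smul_mixablePoly_succ, Polynomial.smul_eq_C_mul]
  ring

theorem span_range_mixablePoly :
    Submodule.span C (Set.range (mixablePoly lam)) = ⊤ := by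
  set S := Submodule.span C (Set.range (mixablePoly lam))
  have mem (n : ℕ) : mixablePoly lam n ∈ S := Submodule.subset_span ⟨n, rfl⟩
  have X_mul_mem {u : Polynomial C} (hu : u ∈ S) : Polynomial.X * u ∈ S := by
    induction hu using Submodule.span_induction with
    | mem u hu =>
      obtain ⟨n, rfl⟩ := hu
      rw [X_mul_mixablePoly]
      exact S.add_mem (S.smul_mem _ (mem _)) (S.smul_mem _ (mem _))
    | zero => simp
    | add u v _ _ hu hv => rw [mul_add]; exact S.add_mem hu hv
    | smul c u _ hu => rw [mul_smul_comm]; exact S.smul_mem c hu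
  have X_pow_mem (n : ℕ) : (Polynomial.X : Polynomial C) ^ n ∈ S := by
    induction n with
    | zero => simpa using mem 0
    | succ n ih => rw [pow_succ']; exact X_mul_mem ih
  refine Submodule.eq_top_iff'.2 fun p => ?_
  rw [p.as_sum_range_C_mul_X_pow]
  refine S.sum_mem fun i _ => ?_
  rw [← Polynomial.smul_eq_C_mul]
  exact S.smul_mem _ (X_pow_mem i)

end MixablePoly

section BaxterDefect

variable {C : Type*} [CommRing C] (lam : C) (Q : Polynomial C →ₗ[C] Polynomial C)

/-- The failure of the Baxter identity of weight `lam` for `Q`, as a bilinear map. -/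
noncomputable def baxterDefect : Polynomial C →ₗ[C] Polynomial C →ₗ[C] Polynomial C :=
  LinearMap.mk₂ C
    (fun u v => Q u * Q v - Q (u * Q v) - Q (v * Q u) - lam • Q (u * v))
    (fun u u' v => by simp only [map_add, add_mul, mul_add, smul_add]; ring)
    (fun c u v => by
      simp only [map_smul, smul_mul_assoc, mul_smul_comm, smul_sub, smul_comm lam c])
    (fun u v v' => by simp only [map_add, add_mul, mul_add, smul_add]; ring)
    (fun c u v => by
      simp only [map_smul, smul_mul_assoc, mul_smul_comm, smul_sub, smul_comm lam c])

theorem baxterDefect_apply (u v : Polynomial C) :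
    baxterDefect lam Q u v =
      Q u * Q v - Q (u * Q v) - Q (v * Q u) - lam • Q (u * v) :=
  rfl

variable {lam Q}

theorem baxterDefect_X_mul
    (hX : ∀ f, Q (Polynomial.X * f) = Polynomial.X * Q f - Q (Q f) - lam • Q f)
    {u v : Polynomial C} (h : baxterDefect lam Q u v = 0) :
    baxterDefect lam Q (Polynomial.X * u) v = -baxterDefect lam Q (Q u) v := by
  rw [baxterDefect_apply] at h
  have hQ := congrArg Q h
  simp only [map_sub, map_smul, map_zero] at hQ
  have hv : v * Q (Polynomial.X * u) =
      Polynomial.X * (v * Q u) - v * Q (Q u) - lam • (v * Q u) := by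
    rw [hX, mul_sub, mul_sub, mul_smul_comm]
    ring
  rw [baxterDefect_apply, baxterDefect_apply, hv, mul_assoc, mul_assoc]
  simp only [map_sub, map_smul, hX]
  rw [mul_comm (Q u) v]
  simp only [Polynomial.smul_eq_C_mul] at h hQ ⊢
  linear_combination (Polynomial.X - Polynomial.C lam) * h - hQ

end BaxterDefect

section MixableShift

variable {C : Type*} [CommRing C] [Algebra ℚ C] {lam : C}
  {Q : Polynomial C →ₗ[C] Polynomial C}

theorem mixableShift_X_mul (hQ : ∀ n, Q (mixablePoly lam n) = mixablePoly lam (n + 1))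
    (f : Polynomial C) :
    Q (Polynomial.X * f) = Polynomial.X * Q f - Q (Q f) - lam • Q f := by
  have hf : f ∈ Submodule.span C (Set.range (mixablePoly lam)) := by
    rw [span_range_mixablePoly]
    trivial
  induction hf using Submodule.span_induction with
  | mem f hf =>
    obtain ⟨n, rfl⟩ := hf
    simp only [X_mul_mixablePoly, map_add, map_smul, hQ]
    push_cast
    module
  | zero => simp
  | add u v _ _ hu hv => simp only [mul_add, map_add, smul_add, hu, hv]; ring
  | smul c u _ hu => simp only [mul_smul_comm, map_smul, hu, smul_sub, smul_comm lam c]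

theorem baxterDefect_mixableShift
    (hQ : ∀ n, Q (mixablePoly lam n) = mixablePoly lam (n + 1)) :
    baxterDefect lam Q = 0 := by
  have hX := mixableShift_X_mul hQ
  have hQ_one : Q 1 = Polynomial.X := by simpa using hQ 0
  refine LinearMap.ext_on_range (span_range_mixablePoly lam) fun n => LinearMap.ext fun v => ?_
  rw [LinearMap.zero_apply, LinearMap.zero_apply]
  induction n with
  | zero =>
    rw [mixablePoly_zero, baxterDefect_apply, hQ_one, mul_comm v, hX]
    simp only [one_mul]
    ring
  | succ n ih =>
    have h := baxterDefect_X_mul hX ih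
    rw [X_mul_mixablePoly, hQ, map_add, map_smul, map_smul, LinearMap.add_apply,
      LinearMap.smul_apply, LinearMap.smul_apply, ih, smul_zero, add_zero] at h
    set e := baxterDefect lam Q (mixablePoly lam (n + 1)) v
    have hsmul : algebraMap ℚ C (n + 2) • e = 0 := by
      have hcast : algebraMap ℚ C (n + 2) = ((n : C) + 1) + 1 := by
        simp only [map_add, map_natCast, map_ofNat]
        ring
      rw [hcast, add_smul, one_smul, h, neg_add_cancel]
    rw [algebraMap_smul] at hsmul
    exact (smul_eq_zero.1 hsmul).resolve_left (by positivity)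

end MixableShift

/-- If `Q : C[x] → C[x]` is a `C`-linear map with `Q(p_n) = p_{n+1}` for all
`n ≥ 0`, then `Q` is a Baxter operator of weight `λ`, i.e.
`Q(u)Q(v) = Q(uQ(v)) + Q(vQ(u)) + λQ(uv)` for all `u, v ∈ C[x]`.
In particular `Q(1) = x`. -/
theorem mixableShift_is_baxter {C : Type*} [CommRing C] [Algebra ℚ C] (lam : C)
    (Q : Polynomial C →ₗ[C] Polynomial C)
    (hQ : ∀ n : ℕ, Q (mixablePoly lam n) = mixablePoly lam (n + 1)) :
    (∀ u v : Polynomial C,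
        Q u * Q v = Q (u * Q v) + Q (v * Q u) + Polynomial.C lam * Q (u * v)) ∧
      Q 1 = Polynomial.X := by
  refine ⟨fun u v => ?_, by simpa using hQ 0⟩
  have h : baxterDefect lam Q u v = 0 := by simp [baxterDefect_mixableShift hQ]
  rw [baxterDefect_apply, Polynomial.smul_eq_C_mul] at h
  linear_combination h
end

section
/- Let A be the polynomial ring over ℚ in countably many variables X₀, X₁, X₂, …, and let R be the ring of sequences ℕ → A with componentwise operations. Define the weight-1 Baxter operator P on R by P(a)(m) = Σ_{i<m} a(i), and let x ∈ R be the sequence x(m) = X_m. Define the iterates (Px)^{[0]} = 1 and (Px)^{[n+1]} = P(x·(Px)^{[n]}). Then for all n ≥ 1 and all m ∈ ℕ, the m-th entry of (Px)^{[n]} equals the elementary symmetric polynomial of degree n in the variables X₀, …, X_{m−1}, i.e., (Px)^{[n]}(m) = Σ_{S ⊆ {0,…,m−1}, |S| = n} ∏_{i∈S} X_i. -/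
/-- The partial-sum (weight-1 Baxter) operator `P(a)(m) = Σ_{i<m} a(i)` on the ring
of sequences with values in `A = ℚ[X₀, X₁, X₂, …]`, with componentwise operations. -/
noncomputable def partialSumOp (a : ℕ → MvPolynomial ℕ ℚ) : ℕ → MvPolynomial ℕ ℚ :=
  fun m => ∑ i ∈ Finset.range m, a i

/-- The iterates `(Px)^{[0]} = 1`, `(Px)^{[n+1]} = P(x·(Px)^{[n]})`, where `x` is the
sequence `x(m) = X_m`. -/
noncomputable def iterPx : ℕ → (ℕ → MvPolynomial ℕ ℚ)
  | 0 => fun _ => 1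
  | n + 1 => partialSumOp fun m => MvPolynomial.X m * iterPx n m

theorem Finset.sum_powersetCard_succ_insert_prod {ι R : Type*} [DecidableEq ι] [CommSemiring R]
    {s : Finset ι} {a : ι} (ha : a ∉ s) (n : ℕ) (f : ι → R) :
    ∑ S ∈ powersetCard (n + 1) (insert a s), ∏ i ∈ S, f i =
      ∑ S ∈ powersetCard (n + 1) s, ∏ i ∈ S, f i +
        f a * ∑ S ∈ powersetCard n s, ∏ i ∈ S, f i := by
  have notMem {k : ℕ} {S : Finset ι} (hS : S ∈ powersetCard k s) : a ∉ S :=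
    fun h => ha ((mem_powersetCard.1 hS).1 h)
  rw [powersetCard_succ_insert ha, sum_union, sum_image, mul_sum]
  · congr 1
    exact sum_congr rfl fun S hS => prod_insert (notMem hS)
  · intro S hS T hT h
    rw [← erase_insert (notMem hS), ← erase_insert (notMem hT)]
    exact congrArg (fun U => erase U a) h
  · rw [disjoint_left]
    intro S hS hS'
    obtain ⟨T, -, rfl⟩ := mem_image.1 hS'
    exact notMem hS (mem_insert_self a T)

theorem iterPx_eq_sum_powersetCard (n m : ℕ) :
    iterPx n m =
      ∑ S ∈ Finset.powersetCard n (Finset.range m), ∏ i ∈ S, MvPolynomial.X i := by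
  induction n generalizing m with
  | zero => simp [iterPx]
  | succ n ihn =>
    induction m with
    | zero =>
      rw [Finset.range_zero, Finset.powersetCard_eq_empty.2 n.succ_pos]
      rfl
    | succ m ihm =>
      rw [Finset.range_add_one,
        Finset.sum_powersetCard_succ_insert_prod Finset.notMem_range_self, ← ihm, ← ihn]
      exact Finset.sum_range_succ _ m

/-- For all `n ≥ 1` and all `m`, the `m`-th entry of `(Px)^{[n]}` is the elementary
symmetric polynomial of degree `n` in the variables `X₀, …, X_{m−1}`:
`(Px)^{[n]}(m) = Σ_{S ⊆ {0,…,m−1}, |S| = n} ∏_{i∈S} X_i`. -/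
theorem iterPx_eq_esymm (n : ℕ) (hn : 1 ≤ n) (m : ℕ) :
    iterPx n m =
      ∑ S ∈ Finset.powersetCard n (Finset.range m), ∏ i ∈ S, MvPolynomial.X i :=
  iterPx_eq_sum_powersetCard n m
end

section
/- (Spitzer's identity, coefficientwise form.) Let C be a commutative ℚ-algebra and let (R, P) be a Baxter C-algebra of weight 1. For b ∈ R define the iterates (Pb)^{[0]} = 1 and (Pb)^{[n+1]} = P(b·(Pb)^{[n]}). Then for every n ≥ 1, n·(Pb)^{[n]} = Σ_{k=1}^{n} (−1)^{k−1}·P(bᵏ)·(Pb)^{[n−k]}. (This system of identities is, over a ℚ-algebra, equivalent to the generating-function form exp(−P(log(1+tb)^{−1})) = Σ_{n≥0} tⁿ (Pb)^{[n]} in R[[t]], since taking logarithmic derivatives in t of the power series identity yields exactly these coefficient relations.) -/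
/-- The iterates `(Pb)^{[0]} = 1`, `(Pb)^{[n+1]} = P(b·(Pb)^{[n]})`. -/
def baxterIter {R : Type*} [CommRing R] (P : R → R) (b : R) : ℕ → R
  | 0 => 1
  | n + 1 => P (b * baxterIter P b n)

open Finset in
/-- Spitzer's identity for an additive Baxter operator of weight `1`, as a convolution sum. -/
theorem sum_antidiagonal_baxterIter {R : Type*} [CommRing R] (P : R →+ R)
    (hP : ∀ u v : R, P u * P v = P (u * P v) + P (v * P u) + P (u * v)) (b : R) (n : ℕ) :
    ∑ p ∈ antidiagonal n, (-1 : R) ^ p.1 * P (b ^ (p.1 + 1)) * baxterIter P b p.2 =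
      (n + 1 : ℕ) * baxterIter P b (n + 1) := by
  have map_sign (i : ℕ) (x : R) : P ((-1) ^ i * x) = (-1) ^ i * P x := by
    rcases neg_one_pow_eq_or R i with h | h <;> simp [h]
  induction n with
  | zero => simp [baxterIter]
  | succ n ih =>
    let g : ℕ × ℕ → R := fun p ↦ (-1) ^ p.1 * P (b ^ (p.1 + 1) * baxterIter P b p.2)
    have expand (p : ℕ × ℕ) :
        (-1 : R) ^ p.1 * P (b ^ (p.1 + 1)) * baxterIter P b (p.2 + 1) =
          g (p.1, p.2 + 1) - g (p.1 + 1, p.2) +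
            P (b * ((-1 : R) ^ p.1 * P (b ^ (p.1 + 1)) * baxterIter P b p.2)) := by
      have h := hP (b ^ (p.1 + 1)) (b * baxterIter P b p.2)
      have e₁ : b * ((-1 : R) ^ p.1 * P (b ^ (p.1 + 1)) * baxterIter P b p.2) =
          (-1) ^ p.1 * (b * baxterIter P b p.2 * P (b ^ (p.1 + 1))) := by ring
      have e₂ : b ^ (p.1 + 1) * (b * baxterIter P b p.2) =
          b ^ (p.1 + 1 + 1) * baxterIter P b p.2 := by ring
      rw [e₂] at h
      rw [e₁, map_sign]
      simp only [g, baxterIter]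
      linear_combination (-1 : R) ^ p.1 * h
    have tele : g (n + 1, 0) + ∑ p ∈ antidiagonal n, g (p.1, p.2 + 1) =
        g (0, n + 1) + ∑ p ∈ antidiagonal n, g (p.1 + 1, p.2) := by
      rw [← Nat.sum_antidiagonal_succ', ← Nat.sum_antidiagonal_succ]
    have first : g (0, n + 1) = baxterIter P b (n + 2) := by simp [g, baxterIter]
    have last : g (n + 1, 0) = (-1) ^ (n + 1) * P (b ^ (n + 1 + 1)) := by simp [g, baxterIter]
    have inner : P (b * ((n + 1 : ℕ) * baxterIter P b (n + 1))) =
        (n + 1 : ℕ) * baxterIter P b (n + 2) := by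
      rw [mul_left_comm, ← nsmul_eq_mul, map_nsmul, nsmul_eq_mul, baxterIter.eq_2 P b (n + 1)]
    rw [Nat.sum_antidiagonal_succ']
    simp only [expand, sum_add_distrib, sum_sub_distrib]
    rw [← map_sum, ← mul_sum, ih, inner]
    simp only [baxterIter.eq_1, mul_one, ← last]
    push_cast
    linear_combination tele + first

/-- Spitzer's identity, coefficientwise form: if `C` is a commutative `ℚ`-algebra
and `(R, P)` is a Baxter `C`-algebra of weight `1`, then for every `b ∈ R` and
every `n ≥ 1`,
`n·(Pb)^{[n]} = Σ_{k=1}^{n} (−1)^{k−1}·P(bᵏ)·(Pb)^{[n−k]}`. -/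
theorem spitzer_identity_coefficientwise {C R : Type*} [CommRing C] [Algebra ℚ C]
    [CommRing R] [Algebra C R] (P : R →ₗ[C] R)
    (hP : ∀ u v : R, P u * P v = P (u * P v) + P (v * P u) + P (u * v))
    (b : R) :
    ∀ n : ℕ, 1 ≤ n →
      (n : R) * baxterIter (⇑P) b n =
        ∑ k ∈ Finset.Icc 1 n, (-1 : R) ^ (k - 1) * P (b ^ k) * baxterIter (⇑P) b (n - k) := by
  intro n hn
  obtain ⟨m, rfl⟩ := Nat.exists_eq_add_of_le' hn
  have h := sum_antidiagonal_baxterIter P.toAddMonoidHom hP b m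
  rw [Finset.Nat.sum_antidiagonal_eq_sum_range_succ_mk] at h
  refine h.symm.trans ?_
  rw [← Finset.Ico_add_one_right_eq_Icc, Finset.sum_Ico_eq_sum_range]
  refine Finset.sum_congr (by simp) fun k _ ↦ ?_
  rw [add_comm 1 k, Nat.add_sub_cancel, Nat.add_sub_add_right]
  rfl
end

section
/- Let C be a field of characteristic zero. Let (f_n)_{n≥0} be a sequence in C[[t]]. Then the following are equivalent: (i) (f_n) is a divided power pseudo-basis of C[[t]], i.e., the order of f_n is n for every n and f_m·f_n = C(m+n,m)·f_{m+n} for all m, n ≥ 0; (ii) there exists a C-algebra automorphism Φ of C[[t]] such that Φ(f_n) = tⁿ/n! for every n ≥ 0. -/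
namespace PowerSeries

/-- Ring automorphisms of `k⟦X⟧` preserve the order, as they fix the maximal ideal. -/
theorem order_ringEquiv_apply {k : Type*} [Field k] (e : k⟦X⟧ ≃+* k⟦X⟧) (φ : k⟦X⟧) :
    (e φ).order = φ.order := by
  have hX : Associated (X : k⟦X⟧) (e X) :=
    IsDiscreteValuationRing.associated_of_irreducible _ X_irreducible
      ((MulEquiv.irreducible_iff e).2 X_irreducible)
  rw [order_eq_emultiplicity_X, order_eq_emultiplicity_X,
    ← emultiplicity_eq_of_associated_left hX, emultiplicity_map_eq e]

/-- Substitution of a power series `P = u X + O(X²)` with `u` a unit is an automorphism. -/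
noncomputable def substAlgEquiv {R : Type*} [CommRing R] (P : R⟦X⟧)
    (hP : P.constantCoeff = 0) (hP' : IsUnit (P.coeff 1)) : R⟦X⟧ ≃ₐ[R] R⟦X⟧ :=
  AlgEquiv.ofAlgHom (substAlgHom (HasSubst.of_constantCoeff_zero' hP))
    (substAlgHom (HasSubst.substInvOfIsUnit P hP'))
    (AlgHom.ext fun φ => by
      rw [AlgHom.comp_apply, AlgHom.id_apply, coe_substAlgHom, coe_substAlgHom,
        subst_comp_subst_apply (HasSubst.substInvOfIsUnit P hP')
        (HasSubst.of_constantCoeff_zero' hP), subst_substInvOfIsUnit_left P hP, X_subst])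
    (AlgHom.ext fun φ => by
      rw [AlgHom.comp_apply, AlgHom.id_apply, coe_substAlgHom, coe_substAlgHom,
        subst_comp_subst_apply (HasSubst.of_constantCoeff_zero' hP)
        (HasSubst.substInvOfIsUnit P hP'), subst_substInvOfIsUnit_right P hP, X_subst])

theorem substAlgEquiv_X {R : Type*} [CommRing R] (P : R⟦X⟧)
    (hP : P.constantCoeff = 0) (hP' : IsUnit (P.coeff 1)) :
    substAlgEquiv P hP hP' X = P :=
  substAlgHom_X (HasSubst.of_constantCoeff_zero' hP)

end PowerSeries

/-- A sequence of divided powers starting at `1` consists of the scaled powers of its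
second term. -/
theorem eq_inv_factorial_smul_pow_of_mul_eq_choose {C A : Type*} [Field C] [CharZero C]
    [CommRing A] [Algebra C A] {f : ℕ → A} (h0 : f 0 = 1)
    (hmul : ∀ m n : ℕ, f m * f n = ((m + n).choose m : A) * f (m + n)) (n : ℕ) :
    f n = ((n.factorial : C)⁻¹) • f 1 ^ n := by
  induction n with
  | zero => simp [h0]
  | succ n ih =>
    have h := hmul n 1
    rw [Nat.choose_succ_self_right, ← map_natCast (algebraMap C A), ← Algebra.smul_def, ih,
      smul_mul_assoc, ← pow_succ] at h
    have hn : ((n + 1 : ℕ) : C) ≠ 0 := Nat.cast_ne_zero.2 n.succ_ne_zero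
    rw [Nat.factorial_succ, Nat.cast_mul, mul_inv, mul_smul, h, inv_smul_smul₀ hn]

/-- The scaled powers `xⁿ/n!` multiply as divided powers. -/
theorem inv_factorial_smul_pow_mul {C A : Type*} [Field C] [CharZero C]
    [CommRing A] [Algebra C A] (x : A) (m n : ℕ) :
    ((m.factorial : C)⁻¹ • x ^ m) * ((n.factorial : C)⁻¹ • x ^ n) =
      ((m + n).choose m : A) * (((m + n).factorial : C)⁻¹ • x ^ (m + n)) := by
  rw [← map_natCast (algebraMap C A), ← Algebra.smul_def, smul_mul_smul_comm, smul_smul, pow_add,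
    Nat.cast_add_choose]
  congr 1
  have hm : ((m + n).factorial : C) ≠ 0 := Nat.cast_ne_zero.2 (m + n).factorial_ne_zero
  field_simp

/-- Let `C` be a field of characteristic zero and `(f_n)` a sequence in `C[[t]]`.
Then `(f_n)` is a divided power pseudo-basis of `C[[t]]` (i.e. `order f_n = n` for
all `n` and `f_m·f_n = C(m+n,m)·f_{m+n}` for all `m, n`) if and only if there is a
`C`-algebra automorphism `Φ` of `C[[t]]` with `Φ(f_n) = tⁿ/n!` for every `n`. -/
theorem divided_power_pseudo_basis_iff_automorphism {C : Type*} [Field C] [CharZero C]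
    (f : ℕ → PowerSeries C) :
    ((∀ n : ℕ, (f n).order = n) ∧
        ∀ m n : ℕ, f m * f n = ((m + n).choose m : PowerSeries C) * f (m + n)) ↔
      ∃ Φ : PowerSeries C ≃ₐ[C] PowerSeries C,
        ∀ n : ℕ, Φ (f n) = ((n.factorial : C)⁻¹) • PowerSeries.X ^ n := by
  open PowerSeries in
  constructor
  · rintro ⟨hord, hmul⟩
    have h0 : f 0 = 1 := by
      have hne : f 0 ≠ 0 := fun h => by simpa [h] using hord 0
      exact mul_left_cancel₀ hne (by simpa using hmul 0 0)
    obtain ⟨h1, hlt⟩ := order_eq_nat.1 (hord 1)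
    have hc : (f 1).constantCoeff = 0 := by simpa using hlt 0 one_pos
    refine ⟨(substAlgEquiv (f 1) hc h1.isUnit).symm, fun n => ?_⟩
    rw [AlgEquiv.symm_apply_eq, map_smul, map_pow, substAlgEquiv_X]
    exact eq_inv_factorial_smul_pow_of_mul_eq_choose h0 hmul n
  · rintro ⟨Φ, hΦ⟩
    refine ⟨fun n => ?_, fun m n => Φ.injective ?_⟩
    · have h := order_ringEquiv_apply (Φ : PowerSeries C ≃+* PowerSeries C) (f n)
      have hn : ((n.factorial : C)⁻¹) ≠ 0 :=
        inv_ne_zero (Nat.cast_ne_zero.2 n.factorial_ne_zero)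
      rw [← h, AlgEquiv.coe_ringEquiv, hΦ, X_pow_eq, ← map_smul, smul_eq_mul, mul_one,
        order_monomial_of_ne_zero _ _ hn]
    · rw [map_mul, map_mul, map_natCast, hΦ, hΦ, hΦ, inv_factorial_smul_pow_mul]
end
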